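/- For angles φ, ψ ∈ ℝ, let 𝔩₁ = 2 sin φ · e₂ − 2 cos φ · e₅ and 𝔩₂ = 2 sin ψ · e₂ − 2 cos ψ · e₅ in ℝ⁶ (the lines through the origin with directions (cos φ, sin φ) and (cos ψ, sin ψ)). Then in Cl(4,2): ι(𝔩₁) · ι(𝔩₂) = 4 cos(φ − ψ) · 1 + 4 sin(φ − ψ) · ι(e₅)ι(e₂). In particular the composition of two reflections in lines through the origin is a scalar multiple of an element of the form cos θ + sin θ · e₅e₂ with (e₅e₂)² = −1. -/

import Mathlib

/-- The bilinear form on `ℝ⁶` whose matrix has entries `B₂₂ = B₅₅ = 1`,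
`B₁₃ = B₃₁ = B₄₆ = B₆₄ = −1` (indices 0-based here). -/
noncomputable def B6 : LinearMap.BilinMap ℝ (Fin 6 → ℝ) ℝ :=
  LinearMap.mk₂ ℝ
    (fun u w => u 1 * w 1 + u 4 * w 4 - u 0 * w 2 - u 2 * w 0 - u 3 * w 5 - u 5 * w 3)
    (by intros; simp only [Pi.add_apply]; ring)
    (by intros; simp only [Pi.smul_apply, smul_eq_mul]; ring)
    (by intros; simp only [Pi.add_apply]; ring)
    (by intros; simp only [Pi.smul_apply, smul_eq_mul]; ring)

/-- The quadratic form `Q(v) = v₂² + v₅² − 2v₁v₃ − 2v₄v₆` on `ℝ⁶`, of signature `(4,2)`. -/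
noncomputable def Q6 : QuadraticForm ℝ (Fin 6 → ℝ) := B6.toQuadraticMap

/-- The standard basis of `ℝ⁶`; `e i` corresponds to `e_{i+1}` in the paper. -/
noncomputable def e (i : Fin 6) : Fin 6 → ℝ := Pi.single i 1

open CliffordAlgebra

/-- The line `𝔩 = 2 sin φ · e₂ − 2 cos φ · e₅` through the origin with
direction `(cos φ, sin φ)`. -/
noncomputable def originLine (φ : ℝ) : Fin 6 → ℝ :=
  (2 * Real.sin φ) • e 1 + (-2 * Real.cos φ) • e 4

theorem ι_e_one_mul_self : ι Q6 (e 1) * ι Q6 (e 1) = 1 := by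
  have h : Q6 (e 1) = 1 := by simp [Q6, B6, e]
  rw [ι_sq_scalar, h, map_one]

theorem ι_e_four_mul_self : ι Q6 (e 4) * ι Q6 (e 4) = 1 := by
  have h : Q6 (e 4) = 1 := by simp [Q6, B6, e]
  rw [ι_sq_scalar, h, map_one]

theorem ι_e_one_mul_ι_e_four : ι Q6 (e 1) * ι Q6 (e 4) = -(ι Q6 (e 4) * ι Q6 (e 1)) := by
  have h : QuadraticMap.polar Q6 (e 1) (e 4) = 0 := by simp [QuadraticMap.polar, Q6, B6, e]
  rw [eq_neg_iff_add_eq_zero, ι_mul_ι_add_swap, h, map_zero]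

/-- the composition of reflections in two lines through the origin is
`ι(𝔩₁)·ι(𝔩₂) = 4 cos(φ − ψ)·1 + 4 sin(φ − ψ)·ι(e₅)ι(e₂)`, a scalar multiple of a
rotation element `cos θ + sin θ · e₅e₂` with `(e₅e₂)² = −1`. -/
theorem reflections_in_origin_lines_compose_to_rotation (φ ψ : ℝ) :
    ι Q6 (originLine φ) * ι Q6 (originLine ψ) =
        (4 * Real.cos (φ - ψ)) • (1 : CliffordAlgebra Q6) +
          (4 * Real.sin (φ - ψ)) • (ι Q6 (e 4) * ι Q6 (e 1)) ∧
      (ι Q6 (e 4) * ι Q6 (e 1)) ^ 2 = -1 := by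
  constructor
  · simp only [originLine, map_add, map_smul, add_mul, mul_add, smul_mul_assoc, mul_smul_comm,
      ι_e_one_mul_self, ι_e_four_mul_self, ι_e_one_mul_ι_e_four, Real.cos_sub, Real.sin_sub]
    module
  · rw [sq, mul_assoc, ← mul_assoc (ι Q6 (e 1)), ι_e_one_mul_ι_e_four, neg_mul, mul_neg,
      mul_assoc, ι_e_one_mul_self, mul_one, ι_e_four_mul_self]
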